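/- For all natural numbers n and k, the following identity of polynomials in y holds: Σ over Motzkin prefixes P of length n and final height k of y^{(number of down steps of P)} · (1+y)^{(number of level steps of P)} = Σ_{j=0}^{n−k} (C(n,j)·C(n,j+k) − C(n,j−1)·C(n,j+k+1)) · y^j, where C(·,·) is the binomial coefficient (zero on negative arguments). -/

import Mathlib

open Finset

inductive Step : Type
  | U | L | D
deriving DecidableEq

instance : Fintype Step where
  elems := {Step.U, Step.L, Step.D}
  complete := by intro x; cases x <;> simp

/-- The vertical displacement of a step: up = +1, level = 0, down = -1. -/
def Step.val : Step → ℤ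
  | .U => 1
  | .L => 0
  | .D => -1

/-- The partial sum of the step values of the first `i` steps;
this is the height at which step `i` starts. -/
def hsum {n : ℕ} (P : Fin n → Step) (i : ℕ) : ℤ :=
  ∑ j ∈ Finset.univ.filter (fun j : Fin n => (j : ℕ) < i), (P j).val

/-- A Motzkin path: all partial sums nonnegative and total sum 0. -/
abbrev IsMotzkin {n : ℕ} (P : Fin n → Step) : Prop :=
  (∀ i : Fin (n+1), 0 ≤ hsum P (i : ℕ)) ∧ hsum P n = 0

/-- A Motzkin prefix of final height `k`: all partial sums nonnegative, total sum `k`. -/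
abbrev IsMPrefix {n : ℕ} (P : Fin n → Step) (k : ℕ) : Prop :=
  (∀ i : Fin (n+1), 0 ≤ hsum P (i : ℕ)) ∧ hsum P n = (k : ℤ)

/-- `[h]_q = 1 + q + ... + q^(h-1)`. -/
def geo {R : Type*} [CommSemiring R] (q : R) (h : ℤ) : R :=
  ∑ i ∈ Finset.range h.toNat, q ^ i

/-- The Gaussian (q-)binomial coefficient, via the q-Pascal recurrence. -/
def qbinom {R : Type*} [CommSemiring R] (q : R) : ℕ → ℕ → R
  | _, 0 => 1
  | 0, _+1 => 0
  | n+1, k+1 => qbinom q n k + q ^ (k+1) * qbinom q n (k+1)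

/-- The binomial coefficient with integer lower argument, zero on negative arguments. -/
def ch (m : ℕ) (j : ℤ) : ℤ := if 0 ≤ j then m.choose j.toNat else 0

open Polynomial in
noncomputable def stw : Step → Polynomial ℤ
  | .U => 1
  | .L => 1 + X
  | .D => X

abbrev Good {n : ℕ} (P : Fin n → Step) : Prop := ∀ i : Fin (n+1), 0 ≤ hsum P (i : ℕ)

noncomputable def GG (n : ℕ) (k : ℤ) : Polynomial ℤ :=
  ∑ P : Fin n → Step, if Good P ∧ hsum P n = k then ∏ i, stw (P i) else 0

def aa (n : ℕ) (k j : ℤ) : ℤ := ch n j * ch n (j + k) - ch n (j - 1) * ch n (j + k + 1)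

lemma hsum_eq {n : ℕ} (P : Fin n → Step) (i : ℕ) :
    hsum P i = ∑ j : Fin n, if (j : ℕ) < i then (P j).val else 0 := by
  rw [hsum, Finset.sum_filter]

lemma hsum_snoc_le {n : ℕ} (P : Fin n → Step) (s : Step) (i : ℕ) (hi : i ≤ n) :
    hsum (Fin.snoc P s : Fin (n+1) → Step) i = hsum P i := by
  rw [hsum_eq, hsum_eq, Fin.sum_univ_castSucc]
  simp [hi]

lemma hsum_snoc_last {n : ℕ} (P : Fin n → Step) (s : Step) :
    hsum (Fin.snoc P s : Fin (n+1) → Step) (n+1) = hsum P n + s.val := by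
  rw [hsum_eq, hsum_eq, Fin.sum_univ_castSucc]
  simp only [Fin.snoc_castSucc, Fin.snoc_last, Fin.val_castSucc, Fin.val_last]
  congr 1
  · refine Finset.sum_congr rfl fun j _ => ?_
    rw [if_pos (by omega), if_pos (by omega)]
  · simp

lemma good_snoc {n : ℕ} (P : Fin n → Step) (s : Step) :
    Good (Fin.snoc P s : Fin (n+1) → Step) ↔ Good P ∧ 0 ≤ hsum P n + s.val := by
  constructor
  · intro h
    refine ⟨fun i => ?_, ?_⟩
    · have := h i.castSucc
      rwa [Fin.val_castSucc, hsum_snoc_le _ _ _ (by omega)] at this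
    · have := h (Fin.last _)
      rwa [Fin.val_last, hsum_snoc_last] at this
  · rintro ⟨h1, h2⟩ i
    refine Fin.lastCases ?_ (fun i => ?_) i
    · rw [Fin.val_last, hsum_snoc_last]; exact h2
    · rw [Fin.val_castSucc, hsum_snoc_le _ _ _ (by omega)]; exact h1 i

lemma GG_neg (n : ℕ) (k : ℤ) (hk : k < 0) : GG n k = 0 := by
  refine Finset.sum_eq_zero fun P _ => ?_
  rw [if_neg]
  rintro ⟨h1, h2⟩
  have := h1 (Fin.last n)
  rw [Fin.val_last] at this
  omega

lemma sum_step {M : Type*} [AddCommMonoid M] (f : Step → M) :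
    ∑ s, f s = f .U + (f .L + f .D) := by
  have : (Finset.univ : Finset Step) = {Step.U, Step.L, Step.D} := rfl
  rw [this, Finset.sum_insert (by simp), Finset.sum_insert (by simp), Finset.sum_singleton]

open Polynomial in
lemma GG_succ (n : ℕ) (k : ℤ) (hk : 0 ≤ k) :
    GG (n+1) k = GG n (k-1) + ((1 + X) * GG n k + X * GG n (k+1)) := by
  have key : ∀ s : Step, (∑ P : Fin n → Step,
      if Good (Fin.snoc P s : Fin (n+1) → Step) ∧
        hsum (Fin.snoc P s : Fin (n+1) → Step) (n+1) = k then
        ∏ i, stw ((Fin.snoc P s : Fin (n+1) → Step) i) else 0) = stw s * GG n (k - s.val) := by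
    intro s
    rw [GG, Finset.mul_sum]
    refine Finset.sum_congr rfl fun P _ => ?_
    rw [Fin.prod_univ_castSucc]
    simp only [Fin.snoc_castSucc, Fin.snoc_last]
    by_cases h : Good P ∧ hsum P n = k - s.val
    · rw [if_pos h, if_pos ⟨(good_snoc P s).2 ⟨h.1, by omega⟩, by rw [hsum_snoc_last]; omega⟩, mul_comm]
    · rw [if_neg h, if_neg, mul_zero]
      rintro ⟨h0, h3⟩
      obtain ⟨h1, h2⟩ := (good_snoc P s).1 h0
      rw [hsum_snoc_last] at h3
      exact h ⟨h1, by omega⟩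
  rw [GG, ← (Fin.snocEquiv (fun _ : Fin (n+1) => Step)).sum_comp, Fintype.sum_prod_type, sum_step]
  have e := fun s => key s
  simp only [Fin.snocEquiv_apply]
  refine congrArg₂ _ ((e .U).trans ?_) (congrArg₂ _ ((e .L).trans ?_) ((e .D).trans ?_))
  · simp [stw, Step.val]
  · simp [stw, Step.val]
  · simp [stw, Step.val]

lemma ch_neg (m : ℕ) (j : ℤ) (h : j < 0) : ch m j = 0 := if_neg (by omega)

lemma ch_big (m : ℕ) (j : ℤ) (h : (m : ℤ) < j) : ch m j = 0 := by
  rw [ch, if_pos (by omega), Nat.choose_eq_zero_of_lt (by omega)]; rfl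

lemma ch_succ (m : ℕ) (j : ℤ) : ch (m+1) j = ch m j + ch m (j-1) := by
  rcases lt_trichotomy j 0 with h | h | h
  · simp [ch_neg, h, show j - 1 < 0 by omega]
  · subst h; simp [ch]
  · obtain ⟨i, rfl⟩ : ∃ i : ℕ, j = i + 1 := ⟨(j-1).toNat, by omega⟩
    rw [ch, ch, ch, if_pos (by omega), if_pos (by omega), if_pos (by omega)]
    rw [show ((i:ℤ)+1).toNat = i + 1 by omega, show ((i:ℤ)+1-1).toNat = i by omega,
      Nat.choose_succ_succ]
    push_cast; ring

lemma aa_succ (n : ℕ) (k j : ℤ) : aa (n+1) k j =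
    aa n (k-1) j + (aa n k j + aa n k (j-1) + aa n (k+1) (j-1)) := by
  simp only [aa, ch_succ]
  ring_nf

lemma aa_neg (n : ℕ) (k j : ℤ) (h : j < 0) : aa n k j = 0 := by
  rw [aa, ch_neg _ _ h, ch_neg _ (j-1) (by omega)]; ring

open Polynomial in
lemma GG_coeff (n : ℕ) : ∀ (k : ℤ) (_ : -1 ≤ k) (j : ℕ), (GG n k).coeff j = aa n k j := by
  have hneg : ∀ (n j : ℕ), (GG n (-1)).coeff j = aa n (-1) j := by
    intro n j
    rw [GG_neg _ _ (by omega), aa, show (j:ℤ) + -1 + 1 = j by ring,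
      show (j:ℤ) + -1 = j - 1 by ring]
    simp; ring
  induction n with
  | zero =>
    intro k hk j
    rcases eq_or_lt_of_le hk with h | h
    · rw [← h]; exact hneg _ _
    have h0 : 0 ≤ k := by omega
    have : GG 0 k = if k = 0 then 1 else 0 := by
      simp [GG, Good, hsum, eq_comm]
    rw [this, aa, ch_big 0 ((j:ℤ) + k + 1) (by push_cast; omega)]
    rcases eq_or_lt_of_le h0 with h1 | h1
    · subst h1
      rcases Nat.eq_zero_or_pos j with hj | hj
      · subst hj; simp [ch]
      · rw [ch_big 0 (j:ℤ) (by omega)]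
        simp [Polynomial.coeff_one]; omega
    · rw [ch_big 0 ((j:ℤ) + k) (by push_cast; omega), if_neg (by omega)]
      simp
  | succ n ih =>
    intro k hk j
    rcases eq_or_lt_of_le hk with h | h
    · rw [← h]; exact hneg _ _
    rw [GG_succ _ _ (by omega), aa_succ, add_mul, one_mul]
    simp only [coeff_add]
    rw [ih (k-1) (by omega), ih k hk]
    cases j with
    | zero => simp [aa_neg]
    | succ j =>
      rw [coeff_X_mul, coeff_X_mul, ih k hk, ih (k+1) (by omega)]
      push_cast
      simp

open Polynomial in
/-- The generating function of Motzkin prefixes of length `n` and final height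
`k` with weight `y` on down steps and `1 + y` on level steps. -/
theorem stmt11 (n k : ℕ) :
    ∑ P ∈ Finset.univ.filter (fun P : Fin n → Step => IsMPrefix P k),
        (X : Polynomial ℤ) ^ (Finset.univ.filter (fun i => P i = Step.D)).card *
        (1 + X) ^ (Finset.univ.filter (fun i => P i = Step.L)).card
    = ∑ j ∈ Finset.range (n-k+1),
        ((ch n (j : ℤ) * ch n ((j : ℤ) + k)
          - ch n ((j : ℤ) - 1) * ch n ((j : ℤ) + k + 1) : ℤ) : Polynomial ℤ) *
        X ^ j := by
  have hL : ∑ P ∈ Finset.univ.filter (fun P : Fin n → Step => IsMPrefix P k),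
        (X : Polynomial ℤ) ^ (Finset.univ.filter (fun i => P i = Step.D)).card *
        (1 + X) ^ (Finset.univ.filter (fun i => P i = Step.L)).card = GG n k := by
    rw [Finset.sum_filter, GG]
    refine Finset.sum_congr rfl fun P _ => ?_
    congr 1
    rw [← Finset.prod_const, ← Finset.prod_const, Finset.prod_filter, Finset.prod_filter,
      ← Finset.prod_mul_distrib]
    refine Finset.prod_congr rfl fun i _ => ?_
    cases P i <;> simp [stw]
  rw [hL]
  ext j
  rw [GG_coeff n k (by omega), Polynomial.finsetSum_coeff]
  have : ∀ b ∈ Finset.range (n-k+1), (((ch n (b : ℤ) * ch n ((b : ℤ) + k)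
          - ch n ((b : ℤ) - 1) * ch n ((b : ℤ) + k + 1) : ℤ) : Polynomial ℤ) *
        X ^ b).coeff j = if j = b then aa n k b else 0 := by
    intro b _
    rw [← Polynomial.C_eq_intCast, Polynomial.coeff_C_mul_X_pow]
    simp [aa]
  rw [Finset.sum_congr rfl this, Finset.sum_ite_eq]
  split_ifs with h
  · rfl
  · rw [Finset.mem_range] at h
    rw [aa, ch_big n ((j:ℤ) + k) (by omega), ch_big n ((j:ℤ) + k + 1) (by omega)]
    ring
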